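/- Let X, Y, A, B : [0,T] → ℝ be nonnegative functions with X continuously differentiable, satisfying X'(t) + Y(t) ≤ A(t)·X(t) + B(t)·X(t)·log(1 + Y(t)) for all t ∈ [0,T], with A integrable and B square-integrable on [0,T]. Then for all t ∈ [0,T], X(t) ≤ (1 + X(0))^(exp(∫₀^t B(τ)dτ)) · exp(∫₀^t exp(∫_s^t B(τ)dτ)·(A(s) + B(s)²) ds). -/

import Mathlib

open MeasureTheory Filter Set

/-- Absolute continuity is preserved under composition with a Lipschitz map. -/
theorem LipschitzOnWith.comp_absolutelyContinuousOnInterval {E F : Type*} [PseudoMetricSpace E]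
    [PseudoMetricSpace F] {φ : E → F} {K : NNReal} {S : Set E} {f : ℝ → E} {a b : ℝ}
    (hφ : LipschitzOnWith K φ S) (hf : AbsolutelyContinuousOnInterval f a b)
    (hS : MapsTo f (uIcc a b) S) :
    AbsolutelyContinuousOnInterval (fun x => φ (f x)) a b := by
  have hlim := Tendsto.const_mul (K : ℝ) hf
  rw [mul_zero] at hlim
  refine squeeze_zero' (Eventually.of_forall fun _ => Finset.sum_nonneg fun _ _ => dist_nonneg)
    ?_ hlim
  filter_upwards [mem_inf_of_right (mem_principal_self _)] with E hE
  rw [Finset.mul_sum]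
  exact Finset.sum_le_sum fun i hi =>
    hφ.dist_le_mul _ (hS (hE.1 i hi).1) _ (hS (hE.1 i hi).2)

/-- The exponential of an absolutely continuous function is absolutely continuous. -/
theorem AbsolutelyContinuousOnInterval.exp {f : ℝ → ℝ} {a b : ℝ}
    (hf : AbsolutelyContinuousOnInterval f a b) :
    AbsolutelyContinuousOnInterval (fun x => Real.exp (f x)) a b := by
  obtain ⟨M, hM⟩ := hf.exists_bound
  obtain ⟨K, hK⟩ := (Real.contDiff_exp (n := 1)).contDiffOn.exists_lipschitzOnWith one_ne_zero
    (convex_Icc (-M) M) isCompact_Icc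
  exact hK.comp_absolutelyContinuousOnInterval hf fun x hx => abs_le.mp (hM x hx)

/-- Grönwall's inequality in integral form, with an integrable nonnegative kernel. -/
theorem le_of_le_add_integral_add_mul {a b : ℝ} (hab : a ≤ b) {L B C : ℝ → ℝ}
    (hL : ContinuousOn L (Icc a b)) (hB : IntervalIntegrable B volume a b)
    (hC : IntervalIntegrable C volume a b) (hBnn : ∀ s ∈ Icc a b, 0 ≤ B s)
    (h : ∀ s ∈ Icc a b, L s ≤ L a + ∫ r in a..s, (C r + B r * L r)) :
    L b ≤ Real.exp (∫ r in a..b, B r) * L a +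
      ∫ s in a..b, Real.exp (∫ r in s..b, B r) * C s := by
  rw [← uIcc_of_le hab] at hL
  have hφ : IntervalIntegrable (fun r => C r + B r * L r) volume a b :=
    hC.add (hB.mul_continuousOn hL)
  set E : ℝ → ℝ := fun s => Real.exp (∫ r in s..b, B r) with hE
  set v : ℝ → ℝ := fun s => L a + ∫ r in a..s, (C r + B r * L r) with hv
  have hEac : AbsolutelyContinuousOnInterval E a b := by
    have := (hB.absolutelyContinuousOnInterval_intervalIntegral right_mem_uIcc).fun_neg.exp
    simpa only [← intervalIntegral.integral_symm] using this
  have hvac : AbsolutelyContinuousOnInterval v a b :=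
    (LipschitzWith.const (L a)).lipschitzOnWith.absolutelyContinuousOnInterval.fun_add
      (hφ.absolutelyContinuousOnInterval_intervalIntegral left_mem_uIcc)
  have hFTC := hEac.integral_deriv_mul_eq_sub hvac
  have hmono : ∫ s in a..b, (deriv E s * v s + E s * deriv v s) ≤ ∫ s in a..b, E s * C s := by
    refine intervalIntegral.integral_mono_ae_restrict hab
      ((hEac.intervalIntegrable_deriv.mul_continuousOn hvac.continuousOn).add
        (hvac.intervalIntegrable_deriv.continuousOn_mul hEac.continuousOn))
      (hC.continuousOn_mul hEac.continuousOn) ?_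
    refine (ae_restrict_iff' measurableSet_Icc).mpr ?_
    filter_upwards [hB.ae_hasDerivAt_integral, hφ.ae_hasDerivAt_integral] with s hs₁ hs₂ hs
    have hs' : s ∈ uIcc a b := by rwa [uIcc_of_le hab]
    have hdE : HasDerivAt E (E s * -B s) s := by
      have := (hs₁ hs' b right_mem_uIcc).fun_neg.exp
      simpa only [← intervalIntegral.integral_symm] using this
    have hdv : HasDerivAt v (C s + B s * L s) s := (hs₂ hs' a left_mem_uIcc).const_add _
    rw [hdE.deriv, hdv.deriv]
    have : 0 ≤ E s * (B s * (v s - L s)) :=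
      mul_nonneg (Real.exp_pos _).le (mul_nonneg (hBnn s hs) (sub_nonneg.mpr (h s hs)))
    linarith
  have hEb : E b = 1 := by simp [hE]
  have hva : v a = L a := by simp [hv]
  rw [hEb, hva] at hFTC
  have := h b (right_mem_Icc.mpr hab)
  linarith

/-- The pointwise bound behind the logarithmic Grönwall inequality. -/
theorem div_one_add_le_of_add_le_mul_log {x y a b d : ℝ} (hx : 0 ≤ x) (hy : 0 ≤ y) (ha : 0 ≤ a)
    (hb : 0 ≤ b) (h : d + y ≤ a * x + b * x * Real.log (1 + y)) :
    d / (1 + x) ≤ a + b ^ 2 + b * Real.log (1 + x) := by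
  have hx1 : 0 < 1 + x := by linarith
  set z := y / (1 + x)
  have hz0 : 0 ≤ z := by positivity
  have hyz : y = z * (1 + x) := (div_mul_cancel₀ y hx1.ne').symm
  have hlog : Real.log (1 + y) ≤ Real.log (1 + x) + Real.log (1 + z) := by
    rw [← Real.log_mul (by positivity) (by positivity)]
    exact Real.log_le_log (by positivity) (by nlinarith)
  have hsq : b * Real.log (1 + z) ≤ z + b ^ 2 := by
    have h1 : Real.log (1 + z) ≤ 2 * √z := by
      rw [show 2 * √z = Real.log (Real.exp √z ^ 2) by simp]
      refine Real.log_le_log (by positivity) ?_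
      have := Real.add_one_le_exp √z
      nlinarith [Real.sq_sqrt hz0, Real.sqrt_nonneg z]
    nlinarith [mul_le_mul_of_nonneg_left h1 hb, sq_nonneg (√z - b), Real.sq_sqrt hz0]
  have hlogy : 0 ≤ Real.log (1 + y) := Real.log_nonneg (by linarith)
  have hkey : b * Real.log (1 + y) ≤ z + b ^ 2 + b * Real.log (1 + x) := by
    nlinarith [mul_le_mul_of_nonneg_left hlog hb]
  rw [div_le_iff₀ hx1]
  nlinarith [mul_le_mul_of_nonneg_right hkey hx1.le, mul_nonneg hb hlogy]

/-- Logarithmic Grönwall inequality: if `X' + Y ≤ A·X + B·X·log(1+Y)` on `[0,T]`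
with `X, Y, A, B ≥ 0`, `A ∈ L¹(0,T)`, `B ∈ L²(0,T)`, then
`X(t) ≤ (1+X(0))^{exp(∫₀ᵗ B)} · exp(∫₀ᵗ exp(∫ₛᵗ B)(A(s)+B(s)²) ds)`. -/
theorem log_gronwall (T : ℝ) (hT : 0 < T) (X Y A B X' : ℝ → ℝ)
    (hX : ∀ t ∈ Icc (0:ℝ) T, HasDerivAt X (X' t) t)
    (hXnn : ∀ t ∈ Icc (0:ℝ) T, 0 ≤ X t)
    (hYnn : ∀ t ∈ Icc (0:ℝ) T, 0 ≤ Y t)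
    (hAnn : ∀ t ∈ Icc (0:ℝ) T, 0 ≤ A t)
    (hBnn : ∀ t ∈ Icc (0:ℝ) T, 0 ≤ B t)
    (hineq : ∀ t ∈ Icc (0:ℝ) T,
      X' t + Y t ≤ A t * X t + B t * X t * Real.log (1 + Y t))
    (hA : IntegrableOn A (Icc (0:ℝ) T))
    (hB : IntegrableOn (fun t => (B t) ^ 2) (Icc (0:ℝ) T)) :
    ∀ t ∈ Icc (0:ℝ) T,
      X t ≤ (1 + X 0) ^ (Real.exp (∫ τ in (0:ℝ)..t, B τ)) *
        Real.exp (∫ s in (0:ℝ)..t,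
          Real.exp (∫ τ in s..t, B τ) * (A s + (B s) ^ 2)) := by
  intro t ht
  have hsub : Icc 0 t ⊆ Icc 0 T := Icc_subset_Icc_right ht.2
  have hB1 : IntegrableOn B (Icc 0 T) := by
    have hmeas : AEStronglyMeasurable B (volume.restrict (Icc 0 T)) := by
      refine (Real.continuous_sqrt.comp_aestronglyMeasurable hB.aestronglyMeasurable).congr ?_
      filter_upwards [ae_restrict_mem measurableSet_Icc] with s hs using Real.sqrt_sq (hBnn s hs)
    exact ((memLp_two_iff_integrable_sq hmeas).mpr hB).integrable one_le_two
  have hpos : ∀ s ∈ Icc 0 T, 0 < 1 + X s := fun s hs => by linarith [hXnn s hs]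
  have hlog : ∀ s ∈ Icc 0 T, HasDerivAt (fun r => Real.log (1 + X r)) (X' s / (1 + X s)) s :=
    fun s hs => ((hX s hs).const_add 1).log (hpos s hs).ne'
  have hcont : ContinuousOn (fun r => Real.log (1 + X r)) (Icc 0 T) :=
    fun s hs => (hlog s hs).continuousAt.continuousWithinAt
  have hint : IntegrableOn (fun r => A r + B r ^ 2 + B r * Real.log (1 + X r)) (Icc 0 T) :=
    (hA.add hB).add (hB1.mul_continuousOn hcont isCompact_Icc)
  have hIcc : ∀ f : ℝ → ℝ, IntegrableOn f (Icc 0 T) → IntervalIntegrable f volume 0 t :=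
    fun f hf => (intervalIntegrable_iff_integrableOn_Icc_of_le ht.1).mpr (hf.mono_set hsub)
  have hgron := le_of_le_add_integral_add_mul ht.1 (hcont.mono hsub) (hIcc _ hB1)
    (hIcc _ (hA.add hB)) (fun s hs => hBnn s (hsub hs)) fun s hs => by
      have hs' : Icc 0 s ⊆ Icc 0 T := Icc_subset_Icc_right (hsub hs).2
      have := intervalIntegral.sub_le_integral_of_hasDeriv_right_of_le hs.1 (hcont.mono hs')
        (fun r hr => (hlog r (hs' (Ioo_subset_Icc_self hr))).hasDerivWithinAt)
        (hint.mono_set hs') fun r hr => by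
          have hr' := hs' (Ioo_subset_Icc_self hr)
          exact div_one_add_le_of_add_le_mul_log (hXnn r hr') (hYnn r hr') (hAnn r hr')
            (hBnn r hr') (hineq r hr')
      simp only [Pi.add_apply]
      linarith
  calc X t ≤ Real.exp (Real.log (1 + X t)) := by rw [Real.exp_log (hpos t ht)]; linarith
    _ ≤ _ := Real.exp_le_exp.mpr hgron
    _ = _ := by
      rw [Real.exp_add, Real.rpow_def_of_pos (hpos 0 ⟨le_rfl, hT.le⟩), mul_comm (Real.log _)]
      rfl
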